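/- Let n ≥ 2, let c₁, c₂ ∈ ℝ^{n-1} and s₁, s₂ > 0, and suppose the Euclidean closed balls closedBall(c₁, s₁) and closedBall(c₂, s₂) in ℝ^{n-1} are disjoint. Then the Euclidean closed balls in ℝⁿ, closedBall((0, c₁/2), s₁/(2√2)) and closedBall((0, c₂/2), s₂/(2√2)), are causally disjoint, where (0, c) ∈ ℝⁿ denotes the point with time coordinate 0 and spatial part c. -/

import Mathlib

open Set Metric unitInterval

noncomputable section

/-- `n`-dimensional Minkowski space, modeled as `ℝⁿ` with the Euclidean norm. -/
abbrev Mink (n : ℕ) := EuclideanSpace ℝ (Fin n)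

/-- The spatial part `x⃗ = (x 1, …, x (n-1)) ∈ ℝ^{n-1}` of `x ∈ ℝⁿ`. -/
def spatial {n : ℕ} (x : Mink n) : Mink (n - 1) :=
  (WithLp.equiv 2 _).symm fun i : Fin (n - 1) => x ⟨i.1 + 1, by have := i.isLt; omega⟩

/-- A curve `γ` is future-directed causal if it is `C¹` and
`(γ₀)'(t) ≥ ‖(γ⃗)'(t)‖` for all `t ∈ [0,1]`. -/
def FDCausal {n : ℕ} [NeZero n] (γ : ℝ → Mink n) : Prop :=
  ContDiff ℝ 1 γ ∧
    ∀ t ∈ Set.Icc (0 : ℝ) 1,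
      ‖deriv (fun s => spatial (γ s)) t‖ ≤ deriv (fun s => γ s 0) t

/-- A curve `γ` is past-directed causal if it is `C¹` and
`-(γ₀)'(t) ≥ ‖(γ⃗)'(t)‖` for all `t ∈ [0,1]`. -/
def PDCausal {n : ℕ} [NeZero n] (γ : ℝ → Mink n) : Prop :=
  ContDiff ℝ 1 γ ∧
    ∀ t ∈ Set.Icc (0 : ℝ) 1,
      ‖deriv (fun s => spatial (γ s)) t‖ ≤ -(deriv (fun s => γ s 0) t)

/-- A causal curve is a future- or past-directed causal curve. -/
def IsCausalCurve {n : ℕ} [NeZero n] (γ : ℝ → Mink n) : Prop :=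
  FDCausal γ ∨ PDCausal γ

/-- `S` and `T` are causally disjoint if no causal curve starts in `S` and ends in `T`. -/
def CausallyDisjoint {n : ℕ} [NeZero n] (S T : Set (Mink n)) : Prop :=
  ¬ ∃ γ : ℝ → Mink n, IsCausalCurve γ ∧ γ 0 ∈ S ∧ γ 1 ∈ T

/-- The point of `ℝⁿ` with time coordinate `0` and spatial part `c ∈ ℝ^{n-1}`. -/
def fromSpatial {n : ℕ} (c : Mink (n - 1)) : Mink n :=
  (WithLp.equiv 2 _).symm fun i : Fin n =>
    if h : i.1 = 0 then 0 else c ⟨i.1 - 1, by have := i.isLt; omega⟩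

@[simp]
theorem spatial_apply {n : ℕ} (x : Mink n) (i : Fin (n - 1)) :
    spatial x i = x ⟨i.1 + 1, by have := i.isLt; omega⟩ := rfl

theorem spatial_sub {n : ℕ} (x y : Mink n) : spatial (x - y) = spatial x - spatial y := by
  ext i
  simp

@[simp]
theorem spatial_fromSpatial {n : ℕ} (c : Mink (n - 1)) :
    spatial (fromSpatial c : Mink n) = c := by
  ext i
  simp [fromSpatial]

@[simp]
theorem fromSpatial_zero {n : ℕ} [NeZero n] (c : Mink (n - 1)) :
    (fromSpatial c : Mink n) 0 = 0 := by
  simp [fromSpatial]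

theorem norm_sq_eq_time_add_spatial {n : ℕ} [NeZero n] (x : Mink n) :
    ‖x‖ ^ 2 = x 0 ^ 2 + ‖spatial x‖ ^ 2 := by
  obtain ⟨m, rfl⟩ := Nat.exists_eq_succ_of_ne_zero (NeZero.ne n)
  rw [EuclideanSpace.real_norm_sq_eq, EuclideanSpace.real_norm_sq_eq]
  exact Fin.sum_univ_succ fun i => x i ^ 2

theorem contDiff_spatial {n : ℕ} {γ : ℝ → Mink n} (hγ : ContDiff ℝ 1 γ) :
    ContDiff ℝ 1 fun t => spatial (γ t) :=
  contDiff_euclidean.2 fun _ => contDiff_euclidean.1 hγ _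

/-- A curve whose speed is bounded by the derivative of `τ` on `[0, 1]` is displaced by at most the
increment of `τ`. -/
theorem norm_sub_le_of_norm_deriv_le_deriv {E : Type*} [NormedAddCommGroup E] [NormedSpace ℝ E]
    {f : ℝ → E} {τ : ℝ → ℝ} (hf : Differentiable ℝ f) (hτ : Differentiable ℝ τ)
    (h : ∀ t ∈ Set.Icc (0 : ℝ) 1, ‖deriv f t‖ ≤ deriv τ t) :
    ‖f 1 - f 0‖ ≤ τ 1 - τ 0 :=
  image_norm_le_of_norm_deriv_right_le_deriv_boundary (a := 0) (b := 1)
    (f := fun t => f t - f 0) (f' := deriv f) (B := fun t => τ t - τ 0) (B' := deriv τ)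
    (hf.continuous.sub continuous_const).continuousOn
    (fun t _ => ((hf t).hasDerivAt.sub_const _).hasDerivWithinAt) (by simp)
    (fun t => (hτ t).hasDerivAt.sub_const _) (fun t ht => h t (Ico_subset_Icc_self ht))
    (right_mem_Icc.2 zero_le_one)

/-- The endpoints of a causal curve are causally related. -/
theorem IsCausalCurve.norm_spatial_sub_le {n : ℕ} [NeZero n] {γ : ℝ → Mink n}
    (hγ : IsCausalCurve γ) :
    ‖spatial (γ 1) - spatial (γ 0)‖ ≤ |γ 1 0 - γ 0 0| := by
  rcases hγ with ⟨hc, h⟩ | ⟨hc, h⟩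
  · exact (norm_sub_le_of_norm_deriv_le_deriv ((contDiff_spatial hc).differentiable one_ne_zero)
      ((contDiff_euclidean.1 hc 0).differentiable one_ne_zero) h).trans (le_abs_self _)
  · have := norm_sub_le_of_norm_deriv_le_deriv (τ := fun t => -γ t 0)
      ((contDiff_spatial hc).differentiable one_ne_zero)
      ((contDiff_euclidean.1 hc 0).differentiable one_ne_zero).neg
      (fun t ht => by rw [deriv.fun_neg]; exact h t ht)
    refine this.trans (le_trans (le_of_eq ?_) (neg_le_abs _))
    ring

/-- The ball of radius `s / (2√2)` lies in the double cone over the ball of radius `s / 2` in the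
hyperplane of time `0`. -/
theorem abs_time_add_norm_spatial_sub_le {n : ℕ} [NeZero n] {c : Mink (n - 1)} {s : ℝ}
    (hs : 0 ≤ s) {x : Mink n} (hx : x ∈ closedBall (fromSpatial c) (s / (2 * √2))) :
    |x 0| + ‖spatial x - c‖ ≤ s / 2 := by
  rw [mem_closedBall, dist_eq_norm] at hx
  have hnorm := norm_sq_eq_time_add_spatial (x - fromSpatial c)
  rw [spatial_sub, spatial_fromSpatial, PiLp.sub_apply, fromSpatial_zero, sub_zero] at hnorm
  have hsq := pow_le_pow_left₀ (norm_nonneg _) hx 2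
  rw [hnorm, div_pow, mul_pow, Real.sq_sqrt zero_le_two] at hsq
  refine abs_le_of_sq_le_sq' ?_ (by positivity) |>.2
  nlinarith [sq_abs (x 0), sq_nonneg (|x 0| - ‖spatial x - c‖)]

/-- If two balls in `ℝ^{n-1}` are disjoint, then the corresponding scaled balls placed
in the `{t = 0}` hyperplane of `ℝⁿ` are causally disjoint. -/
theorem causallyDisjoint_of_disjoint_spatial (n : ℕ) [NeZero n] (hn : 2 ≤ n)
    (c₁ c₂ : Mink (n - 1)) (s₁ s₂ : ℝ) (hs₁ : 0 < s₁) (hs₂ : 0 < s₂)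
    (hdisj : Disjoint (closedBall c₁ s₁) (closedBall c₂ s₂)) :
    CausallyDisjoint
      (closedBall (fromSpatial ((2⁻¹ : ℝ) • c₁)) (s₁ / (2 * Real.sqrt 2)))
      (closedBall (fromSpatial ((2⁻¹ : ℝ) • c₂)) (s₂ / (2 * Real.sqrt 2))) := by
  rintro ⟨γ, hγ, h₀, h₁⟩
  rw [disjoint_closedBall_closedBall_iff hs₁.le hs₂.le, dist_eq_norm] at hdisj
  have hcausal := hγ.norm_spatial_sub_le
  have hcone₁ := abs_time_add_norm_spatial_sub_le hs₁.le h₀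
  have hcone₂ := abs_time_add_norm_spatial_sub_le hs₂.le h₁
  have htime : |γ 1 0 - γ 0 0| ≤ |γ 1 0| + |γ 0 0| := abs_sub _ _
  have hcenters : ‖(2⁻¹ : ℝ) • c₁ - (2⁻¹ : ℝ) • c₂‖ = 2⁻¹ * ‖c₁ - c₂‖ := by
    rw [← smul_sub, norm_smul, Real.norm_of_nonneg (by norm_num)]
  have htri := norm_add₃_le (a := spatial (γ 1) - (2⁻¹ : ℝ) • c₂)
    (b := -(spatial (γ 1) - spatial (γ 0))) (c := -(spatial (γ 0) - (2⁻¹ : ℝ) • c₁))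
  rw [norm_neg, norm_neg, show spatial (γ 1) - (2⁻¹ : ℝ) • c₂ + -(spatial (γ 1) - spatial (γ 0)) +
    -(spatial (γ 0) - (2⁻¹ : ℝ) • c₁) = (2⁻¹ : ℝ) • c₁ - (2⁻¹ : ℝ) • c₂ by abel, hcenters] at htri
  linarith
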